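/- For every integer n > 3 and every ε ∈ (0,1), there exists x₀ ∈ (0,1) such that the derivative of x ↦ h(x, ε) vanishes at x₀ and h(x₀, ε) > 0. (In the reduced one-parameter description this point gives a degenerate rosette central configuration at the bifurcation value μ₀ = h(x₀, ε).) -/

import Mathlib

/-- `k_n = (1/(4n)) · Σ_{k=1}^{n-1} 1/sin(kπ/n)` -/
noncomputable def kn (n : ℕ) : ℝ :=
  (1 / (4 * n)) * ∑ k ∈ Finset.Icc 1 (n - 1), 1 / Real.sin (k * Real.pi / n)

/-- `φ_k = (2k-1)π/n`, and `u_k = cos φ_k`. -/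
noncomputable def phi (n k : ℕ) : ℝ := (2 * (k : ℝ) - 1) * Real.pi / n

/-- The reduced central configuration function
`h(x, ε) = −n·k_n·(ε−x³)/(1−x³) − (x²/(1−x³))·Σ_{k=1}^{n} [x(1−ε) − (1−εx²)u_k]/(1+x²−2xu_k)^{3/2}`,
where `u_k = cos φ_k`.  Solutions of `h(x, ε) = μ` are the rosette central configurations. -/
noncomputable def h (n : ℕ) (x ε : ℝ) : ℝ :=
  -((n : ℝ) * kn n) * (ε - x ^ 3) / (1 - x ^ 3) -
    (x ^ 2 / (1 - x ^ 3)) * ∑ k ∈ Finset.Icc 1 n,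
      (x * (1 - ε) - (1 - ε * x ^ 2) * Real.cos (phi n k)) /
        (1 + x ^ 2 - 2 * x * Real.cos (phi n k)) ^ ((3 : ℝ) / 2)

lemma rpow_three_halves {D : ℝ} (hD : 0 ≤ D) : D ^ ((3 : ℝ) / 2) = √D ^ 3 := by
  rw [Real.sqrt_eq_rpow, ← Real.rpow_natCast, ← Real.rpow_mul hD]
  norm_num

lemma half_phi_mem_Ioo {n k : ℕ} (hk : k ∈ Finset.Icc 1 n) :
    phi n k / 2 ∈ Set.Ioo 0 Real.pi := by
  obtain ⟨h1, h2⟩ := Finset.mem_Icc.1 hk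
  have h1' : (1 : ℝ) ≤ k := by exact_mod_cast h1
  have h2' : (k : ℝ) ≤ n := by exact_mod_cast h2
  have hpi := Real.pi_pos
  have hn : (0 : ℝ) < n := by linarith
  unfold phi
  constructor
  · have : 0 < 2 * (k : ℝ) - 1 := by linarith
    positivity
  · rw [div_div, div_lt_iff₀ (by positivity)]
    nlinarith

lemma cos_phi_eq (n k : ℕ) : Real.cos (phi n k) = 1 - 2 * Real.sin (phi n k / 2) ^ 2 := by
  have h1 := Real.cos_two_mul (phi n k / 2)
  have h2 := Real.sin_sq_add_cos_sq (phi n k / 2)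
  rw [mul_div_cancel₀ _ two_ne_zero] at h1
  linarith

lemma cos_phi_lt_one {n k : ℕ} (hk : k ∈ Finset.Icc 1 n) : Real.cos (phi n k) < 1 := by
  have := half_phi_mem_Ioo hk
  have := Real.sin_pos_of_mem_Ioo this
  rw [cos_phi_eq]
  nlinarith

lemma dist_sq_pos {x u : ℝ} (hx : 0 ≤ x) (hu : u < 1) : 0 < 1 + x ^ 2 - 2 * x * u := by
  rcases hx.eq_or_lt with rfl | hx
  · norm_num
  · nlinarith [sq_nonneg (1 - x), mul_pos hx (sub_pos.2 hu)]

/-- The numerator of `h` over the common denominator `1 - x ^ 3`. -/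
noncomputable def hNum (n : ℕ) (ε x : ℝ) : ℝ :=
  -((n : ℝ) * kn n) * (ε - x ^ 3) - x ^ 2 * ∑ k ∈ Finset.Icc 1 n,
      (x * (1 - ε) - (1 - ε * x ^ 2) * Real.cos (phi n k)) /
        (1 + x ^ 2 - 2 * x * Real.cos (phi n k)) ^ ((3 : ℝ) / 2)

lemma h_eq_hNum_div (n : ℕ) (x ε : ℝ) : h n x ε = hNum n ε x / (1 - x ^ 3) := by
  unfold h hNum
  ring

lemma continuousAt_hNum (n : ℕ) (ε : ℝ) {x : ℝ} (hx : 0 ≤ x) :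
    ContinuousAt (hNum n ε) x := by
  unfold hNum
  refine ContinuousAt.sub (by fun_prop) (ContinuousAt.mul (by fun_prop) ?_)
  refine tendsto_finsetSum _ fun k hk => ?_
  have hD := dist_sq_pos hx (cos_phi_lt_one hk)
  refine ContinuousAt.div (by fun_prop) ?_ (Real.rpow_pos_of_pos hD _).ne'
  exact ContinuousAt.rpow_const (by fun_prop) (Or.inl hD.ne')

lemma one_sub_cube_pos {x : ℝ} (hx : 0 ≤ x) (hx1 : x < 1) : 0 < 1 - x ^ 3 := by
  have := pow_lt_one₀ hx hx1 (n := 3) (by norm_num)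
  linarith

lemma mul_kn {n : ℕ} (hn : 0 < n) :
    (n : ℝ) * kn n = 1 / 4 * ∑ k ∈ Finset.Icc 1 (n - 1), 1 / Real.sin (k * Real.pi / n) := by
  have : (n : ℝ) ≠ 0 := by positivity
  unfold kn
  rw [← mul_assoc]
  congr 1
  field_simp

lemma two_div_sin_le {m d : ℝ} (h1 : 0 < Real.sin (m - d)) (h2 : 0 < Real.sin (m + d))
    (hm : 0 < Real.sin m) :
    2 / Real.sin m ≤ 1 / Real.sin (m - d) + 1 / Real.sin (m + d) := by
  have hs : Real.sin (m - d) + Real.sin (m + d) ≤ 2 * Real.sin m := by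
    rw [Real.sin_sub, Real.sin_add]
    nlinarith [Real.cos_le_one d]
  set p := Real.sin (m - d)
  set q := Real.sin (m + d)
  have : 2 / Real.sin m ≤ 4 / (p + q) := by
    rw [div_le_div_iff₀ hm (by positivity)]
    linarith
  refine this.trans ?_
  rw [div_add_div _ _ h1.ne' h2.ne', div_le_div_iff₀ (by positivity) (by positivity)]
  nlinarith [sq_nonneg (p - q)]

lemma sin_mul_pi_div_pos {n k : ℕ} (hn : 0 < n) (hk : k ∈ Finset.Icc 1 (n - 1)) :
    0 < Real.sin (k * Real.pi / n) := by
  obtain ⟨h1, h2⟩ := Finset.mem_Icc.1 hk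
  have h1' : (0 : ℝ) < k := by exact_mod_cast h1
  have h2' : (k : ℝ) < n := by exact_mod_cast (by omega : k < n)
  have hn' : (0 : ℝ) < n := by positivity
  have hpi := Real.pi_pos
  refine Real.sin_pos_of_pos_of_lt_pi (by positivity) ?_
  rw [div_lt_iff₀ hn']
  nlinarith

lemma sum_inv_sin_lt {n : ℕ} (hn : 0 < n) :
    ∑ k ∈ Finset.Icc 1 (n - 1), 1 / Real.sin (k * Real.pi / n) <
      ∑ k ∈ Finset.Icc 1 n, 1 / Real.sin (phi n k / 2) := by
  obtain ⟨m, rfl⟩ : ∃ m, n = m + 1 := ⟨n - 1, by omega⟩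
  have hpos : ∀ k ∈ Finset.Icc 1 (m + 1), 0 < Real.sin (phi (m + 1) k / 2) := fun k hk =>
    Real.sin_pos_of_mem_Ioo (half_phi_mem_Ioo hk)
  have key : ∀ k ∈ Finset.Icc 1 m, 2 * (1 / Real.sin (k * Real.pi / (m + 1 : ℕ))) ≤
      1 / Real.sin (phi (m + 1) k / 2) + 1 / Real.sin (phi (m + 1) (k + 1) / 2) := by
    intro k hk
    obtain ⟨h1, h2⟩ := Finset.mem_Icc.1 hk
    have e1 : phi (m + 1) k / 2 =
        k * Real.pi / (m + 1 : ℕ) - Real.pi / (2 * (m + 1 : ℕ)) := by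
      unfold phi; push_cast; field_simp
    have e2 : phi (m + 1) (k + 1) / 2 =
        k * Real.pi / (m + 1 : ℕ) + Real.pi / (2 * (m + 1 : ℕ)) := by
      unfold phi; push_cast; field_simp; ring
    have p1 := hpos k (Finset.mem_Icc.2 ⟨h1, by omega⟩)
    have p2 := hpos (k + 1) (Finset.mem_Icc.2 ⟨by omega, by omega⟩)
    have p3 := sin_mul_pi_div_pos (n := m + 1) (k := k) (by omega) (by simpa using hk)
    rw [e1] at p1 ⊢
    rw [e2] at p2 ⊢
    have := two_div_sin_le p1 p2 p3
    rwa [mul_one_div]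
  have hsum := Finset.sum_le_sum key
  rw [← Finset.mul_sum, Finset.sum_add_distrib] at hsum
  have s1 := Finset.sum_Icc_succ_top (show 1 ≤ m + 1 by omega)
    (fun k => 1 / Real.sin (phi (m + 1) k / 2))
  have s2 : ∑ k ∈ Finset.Icc 1 (m + 1), 1 / Real.sin (phi (m + 1) k / 2) =
      1 / Real.sin (phi (m + 1) 1 / 2) +
        ∑ k ∈ Finset.Icc 1 m, 1 / Real.sin (phi (m + 1) (k + 1) / 2) := by
    rw [← Finset.add_sum_Ioc_eq_sum_Icc (by omega)]
    congr 1
    rw [← Finset.Icc_add_one_left_eq_Ioc, ← Finset.image_add_right_Icc,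
      Finset.sum_image (by simp)]
  have q1 := one_div_pos.2 (hpos (m + 1) (by simp))
  have q2 := one_div_pos.2 (hpos 1 (by simp))
  simp only [Nat.add_sub_cancel]
  linarith

lemma hNum_one_neg {n : ℕ} (hn : 0 < n) {ε : ℝ} (hε : ε < 1) : hNum n ε 1 < 0 := by
  have hterm : ∀ k ∈ Finset.Icc 1 n,
      (1 * (1 - ε) - (1 - ε * 1 ^ 2) * Real.cos (phi n k)) /
        (1 + 1 ^ 2 - 2 * 1 * Real.cos (phi n k)) ^ ((3 : ℝ) / 2) =
      (1 - ε) / 4 * (1 / Real.sin (phi n k / 2)) := by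
    intro k hk
    have hS := Real.sin_pos_of_mem_Ioo (half_phi_mem_Ioo hk)
    have e : 1 + 1 ^ 2 - 2 * 1 * Real.cos (phi n k) = (2 * Real.sin (phi n k / 2)) ^ 2 := by
      rw [cos_phi_eq]; ring
    rw [rpow_three_halves (by rw [e]; positivity), e, Real.sqrt_sq (by positivity), cos_phi_eq]
    field_simp
    ring
  unfold hNum
  rw [Finset.sum_congr rfl hterm, ← Finset.mul_sum, mul_kn hn]
  nlinarith [mul_pos (sub_pos.2 hε) (sub_pos.2 (sum_inv_sin_lt hn))]

lemma exists_critical_of_pos {n : ℕ} (hn : 0 < n) {ε : ℝ} (hε0 : 0 < ε) (hε1 : ε < 1)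
    (hkn : 0 < (n : ℝ) * kn n) {x₁ : ℝ} (hx0 : 0 < x₁) (hx1 : x₁ < 1) (hpos : 0 < h n x₁ ε) :
    ∃ x₀ : ℝ, x₀ ∈ Set.Ioo (0 : ℝ) 1 ∧ deriv (fun x => h n x ε) x₀ = 0 ∧ 0 < h n x₀ ε := by
  obtain ⟨x₂, hN2, hx12, hx21⟩ : ∃ x₂, hNum n ε x₂ < 0 ∧ x₁ < x₂ ∧ x₂ < 1 := by
    have h1 : ∀ᶠ x in nhdsWithin 1 (Set.Iio 1), hNum n ε x < 0 :=
      ((continuousAt_hNum n ε zero_le_one).eventually_lt continuousAt_const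
        (hNum_one_neg hn hε1)).filter_mono nhdsWithin_le_nhds
    have h2 : ∀ᶠ x in nhdsWithin (1 : ℝ) (Set.Iio 1), x ∈ Set.Ioo x₁ 1 :=
      Ioo_mem_nhdsLT hx1
    obtain ⟨x, hx⟩ := (h1.and h2).exists
    exact ⟨x, hx.1, hx.2.1, hx.2.2⟩
  have hcont : ContinuousOn (fun x => h n x ε) (Set.Icc 0 x₂) := by
    intro x hx
    simp only [h_eq_hNum_div]
    exact ((continuousAt_hNum n ε hx.1).div (by fun_prop)
      (one_sub_cube_pos hx.1 (hx.2.trans_lt hx21)).ne').continuousWithinAt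
  obtain ⟨x₀, hx₀, hmax⟩ := isCompact_Icc.exists_isMaxOn ⟨x₁, hx0.le, hx12.le⟩ hcont
  have hpos₀ : 0 < h n x₀ ε := hpos.trans_le (hmax ⟨hx0.le, hx12.le⟩)
  have hne0 : x₀ ≠ 0 := by
    rintro rfl
    have : h n 0 ε = -((n : ℝ) * kn n * ε) := by simp [h]
    rw [this] at hpos₀
    nlinarith [mul_pos hkn hε0]
  have hne2 : x₀ ≠ x₂ := by
    rintro rfl
    rw [h_eq_hNum_div] at hpos₀
    exact absurd (div_neg_of_neg_of_pos hN2 (one_sub_cube_pos hx₀.1 hx21)) hpos₀.not_gt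
  have l0 : 0 < x₀ := lt_of_le_of_ne hx₀.1 hne0.symm
  have l2 : x₀ < x₂ := lt_of_le_of_ne hx₀.2 hne2
  exact ⟨x₀, ⟨l0, l2.trans hx21⟩, (hmax.isLocalMax (Icc_mem_nhds l0 l2)).deriv_eq_zero, hpos₀⟩

lemma sub_div_cube_le {x u q d : ℝ} (hx : 0 < x) (hd : 0 < d) (hq : 0 < q)
    (hD : d ^ 2 = 1 + x ^ 2 - 2 * x * u) (hqx : q ^ 2 ≤ 3 * (1 - x ^ 2)) :
    (x - u) / d ^ 3 ≤ 1 / (3 * q * x) := by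
  rw [div_le_div_iff₀ (by positivity) (by positivity)]
  have h1 : 2 * x * (x - u) ≤ d ^ 2 - q ^ 2 / 3 := by nlinarith
  have h2 : 0 ≤ (d - q) ^ 2 * (2 * d + q) := by positivity
  nlinarith [mul_le_mul_of_nonneg_left h1 hq.le]

lemma neg_inv_cube_le {x u d : ℝ} (hx : 0 < x) (hd : 0 < d) (hu : -1 ≤ u)
    (hD : d ^ 2 = 1 + x ^ 2 - 2 * x * u) : -(1 / (1 + x) ^ 3) ≤ u / d ^ 3 := by
  rcases le_or_gt 0 u with h0 | h0
  · have : 0 ≤ u / d ^ 3 := by positivity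
    have : 0 ≤ 1 / (1 + x) ^ 3 := by positivity
    linarith
  · obtain ⟨v, rfl⟩ : ∃ v, u = -v := ⟨-u, by ring⟩
    rw [neg_div, neg_le_neg_iff, div_le_div_iff₀ (by positivity) (by positivity)]
    have hv0 : 0 < v := by linarith
    have hv1 : v ≤ 1 := by linarith
    have hB : (1 + x) ^ 2 * ((1 + v) / 2) ≤ d ^ 2 := by
      nlinarith [mul_nonneg (sub_nonneg.2 hv1) (sq_nonneg (1 - x))]
    have hB3 := pow_le_pow_left₀ (by positivity) hB 3
    have hv : v ^ 2 ≤ ((1 + v) / 2) ^ 3 := by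
      nlinarith [mul_nonneg (sub_nonneg.2 hv1) (by nlinarith : 0 ≤ 1 + 4 * v - v ^ 2)]
    have hsq : (v * (1 + x) ^ 3) ^ 2 ≤ (d ^ 3) ^ 2 := by
      calc (v * (1 + x) ^ 3) ^ 2 = ((1 + x) ^ 2) ^ 3 * v ^ 2 := by ring
        _ ≤ ((1 + x) ^ 2) ^ 3 * ((1 + v) / 2) ^ 3 := by gcongr
        _ = ((1 + x) ^ 2 * ((1 + v) / 2)) ^ 3 := by ring
        _ ≤ (d ^ 2) ^ 3 := hB3
        _ = (d ^ 3) ^ 2 := by ring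
    rw [one_mul]
    exact (pow_le_pow_iff_left₀ (by positivity) (by positivity) two_ne_zero).1 hsq

lemma sum_Icc_le_of_endpoints {n : ℕ} (hn : 2 ≤ n) {f : ℕ → ℝ} {v G : ℝ} (h1 : f 1 ≤ v)
    (h2 : f n ≤ v) (hG : ∀ k ∈ Finset.Icc 1 n, f k ≤ G) :
    ∑ k ∈ Finset.Icc 1 n, f k ≤ 2 * v + (n - 2) * G := by
  obtain ⟨m, rfl⟩ : ∃ m, n = m + 2 := ⟨n - 2, by omega⟩
  rw [Finset.sum_Icc_succ_top (by omega), ← Finset.add_sum_Ioc_eq_sum_Icc (by omega)]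
  have : ∑ k ∈ Finset.Ioc 1 (m + 1), f k ≤ (Finset.Ioc 1 (m + 1)).card • G :=
    Finset.sum_le_card_nsmul _ _ _ fun k hk => by
      obtain ⟨a, b⟩ := Finset.mem_Ioc.1 hk
      exact hG k (Finset.mem_Icc.2 ⟨by omega, by omega⟩)
  simp only [Nat.card_Ioc, nsmul_eq_mul, Nat.add_sub_cancel] at this
  push_cast
  linarith

lemma cos_phi_one (n : ℕ) : Real.cos (phi n 1) = Real.cos (Real.pi / n) := by
  congr 1
  unfold phi
  push_cast
  ring

lemma cos_phi_self {n : ℕ} (hn : 0 < n) : Real.cos (phi n n) = Real.cos (Real.pi / n) := by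
  have : (n : ℝ) ≠ 0 := by positivity
  rw [← Real.cos_two_pi_sub]
  congr 1
  unfold phi
  field_simp
  ring

lemma sin_pi_div_le {n k : ℕ} (hk : k ∈ Finset.Icc 1 (n - 1)) :
    Real.sin (Real.pi / n) ≤ Real.sin (k * Real.pi / n) := by
  obtain ⟨h1, h2⟩ := Finset.mem_Icc.1 hk
  have h1' : (1 : ℝ) ≤ k := by exact_mod_cast h1
  have h2' : (k : ℝ) + 1 ≤ n := by exact_mod_cast (by omega : k + 1 ≤ n)
  have hn : (0 : ℝ) < n := by linarith
  have hpi := Real.pi_pos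
  have ha : Real.pi / n ≤ k * Real.pi / n := by
    gcongr
    nlinarith
  have hb : k * Real.pi / n + Real.pi / n ≤ Real.pi := by
    rw [← add_div, div_le_iff₀ hn]
    nlinarith
  have h0 : 0 < Real.pi / n := by positivity
  have := Real.sin_sub_sin (k * Real.pi / n) (Real.pi / n)
  have s := Real.sin_nonneg_of_nonneg_of_le_pi
    (by linarith : 0 ≤ (k * Real.pi / n - Real.pi / n) / 2) (by linarith)
  have c := Real.cos_nonneg_of_neg_pi_div_two_le_of_le
    (by linarith : -(Real.pi / 2) ≤ (k * Real.pi / n + Real.pi / n) / 2) (by linarith)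
  nlinarith [mul_nonneg s c]

lemma le_mul_kn {n : ℕ} (hn : 0 < n) : ((n : ℝ) - 1) / 4 ≤ n * kn n := by
  rw [mul_kn hn]
  have := Finset.card_nsmul_le_sum (Finset.Icc 1 (n - 1))
    (fun k : ℕ => 1 / Real.sin (k * Real.pi / n)) 1 fun k hk => by
      rw [le_div_iff₀ (sin_mul_pi_div_pos hn hk), one_mul]
      exact Real.sin_le_one _
  rw [Nat.card_Icc, nsmul_eq_mul, Nat.add_sub_cancel, Nat.cast_sub hn, Nat.cast_one] at this
  linarith

lemma mul_kn_le {n : ℕ} (hn : 0 < n) {σ : ℝ} (hσ : 0 < σ) (hσn : σ ≤ Real.sin (Real.pi / n)) :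
    n * kn n ≤ ((n : ℝ) - 1) / (4 * σ) := by
  rw [mul_kn hn]
  have := Finset.sum_le_card_nsmul (Finset.Icc 1 (n - 1))
    (fun k : ℕ => 1 / Real.sin (k * Real.pi / n)) (1 / σ) fun k hk =>
      one_div_le_one_div_of_le hσ (hσn.trans (sin_pi_div_le hk))
  rw [Nat.card_Icc, nsmul_eq_mul, Nat.add_sub_cancel, Nat.cast_sub hn, Nat.cast_one] at this
  have e : ((n : ℝ) - 1) / (4 * σ) = 1 / 4 * ((n - 1) * (1 / σ)) := by
    field_simp
  rw [e]
  linarith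

/-- Positivity of `h` from explicit bounds: `U` bounds `cos (π / n)` from below, `r` bounds the
distance from `x` to the nearest vertices from above, `σ` bounds `sin (π / n)` from below. The last
two hypotheses are the positivity conditions for `ε = 0` and `ε = 1`. -/
lemma h_pos_of_bounds {n : ℕ} (hn : 2 ≤ n) {ε x U r q σ : ℝ} (hε0 : 0 < ε) (hε1 : ε < 1)
    (hx0 : 0 < x) (hx1 : x < 1) (hU : U ≤ Real.cos (Real.pi / n)) (hxU : x ≤ U) (hr : 0 < r)
    (hrU : 1 + x ^ 2 - 2 * x * U ≤ r ^ 2) (hq : 0 < q) (hqx : q ^ 2 ≤ 3 * (1 - x ^ 2))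
    (hσ : 0 < σ) (hσn : σ ≤ Real.sin (Real.pi / n))
    (hA : ((n : ℝ) - 2) * (1 / (3 * q * x)) < (n - 1) / 4 * x + 2 * ((U - x) / r ^ 3))
    (hB : ((n : ℝ) - 1) / (4 * σ) * (1 - x ^ 3) <
      x ^ 2 * (1 - x ^ 2) * (2 * (U / r ^ 3) - (n - 2) * (1 / (1 + x) ^ 3))) :
    0 < h n x ε := by
  have hn0 : 0 < n := by omega
  have hx3 := one_sub_cube_pos hx0.le hx1
  set d : ℕ → ℝ := fun k => √(1 + x ^ 2 - 2 * x * Real.cos (phi n k)) with hd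
  have hD : ∀ k ∈ Finset.Icc 1 n, 0 < 1 + x ^ 2 - 2 * x * Real.cos (phi n k) := fun k hk =>
    dist_sq_pos hx0.le (cos_phi_lt_one hk)
  have hd0 : ∀ k ∈ Finset.Icc 1 n, 0 < d k := fun k hk => Real.sqrt_pos.2 (hD k hk)
  have hd2 : ∀ k ∈ Finset.Icc 1 n, d k ^ 2 = 1 + x ^ 2 - 2 * x * Real.cos (phi n k) :=
    fun k hk => Real.sq_sqrt (hD k hk).le
  have hend : ∀ k ∈ Finset.Icc 1 n, Real.cos (phi n k) = Real.cos (Real.pi / n) →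
      (x - Real.cos (phi n k)) / d k ^ 3 ≤ -((U - x) / r ^ 3) ∧
        U / r ^ 3 ≤ Real.cos (phi n k) / d k ^ 3 := by
    intro k hk hc
    have hdr : d k ≤ r := by
      refine Real.sqrt_le_iff.2 ⟨hr.le, ?_⟩
      rw [hc]
      nlinarith
    have := hd0 k hk
    rw [← hc] at hU
    constructor
    · rw [← neg_sub (Real.cos _) x, neg_div, neg_le_neg_iff]
      have : 0 ≤ Real.cos (phi n k) - x := by linarith
      gcongr
    · have : 0 ≤ Real.cos (phi n k) := by linarith
      gcongr
  have m1 : 1 ∈ Finset.Icc 1 n := Finset.mem_Icc.2 ⟨le_rfl, by omega⟩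
  have mn : n ∈ Finset.Icc 1 n := Finset.mem_Icc.2 ⟨by omega, le_rfl⟩
  have e1 := hend 1 m1 (cos_phi_one n)
  have en := hend n mn (cos_phi_self hn0)
  have S0 := sum_Icc_le_of_endpoints hn (f := fun k => (x - Real.cos (phi n k)) / d k ^ 3) e1.1 en.1
    fun k hk => sub_div_cube_le hx0 (hd0 k hk) hq (hd2 k hk) hqx
  have S1 := sum_Icc_le_of_endpoints hn (f := fun k => -(Real.cos (phi n k) / d k ^ 3))
    (neg_le_neg e1.2) (neg_le_neg en.2) (G := 1 / (1 + x) ^ 3)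
    fun k hk => neg_le.1 (neg_inv_cube_le hx0 (hd0 k hk) (Real.neg_one_le_cos _) (hd2 k hk))
  rw [Finset.sum_neg_distrib] at S1
  have hsum : ∑ k ∈ Finset.Icc 1 n,
      (x * (1 - ε) - (1 - ε * x ^ 2) * Real.cos (phi n k)) /
        (1 + x ^ 2 - 2 * x * Real.cos (phi n k)) ^ ((3 : ℝ) / 2) =
      (1 - ε) * ∑ k ∈ Finset.Icc 1 n, (x - Real.cos (phi n k)) / d k ^ 3 -
        ε * (1 - x ^ 2) * ∑ k ∈ Finset.Icc 1 n, Real.cos (phi n k) / d k ^ 3 := by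
    rw [Finset.mul_sum, Finset.mul_sum, ← Finset.sum_sub_distrib]
    refine Finset.sum_congr rfl fun k hk => ?_
    rw [rpow_three_halves (hD k hk).le]
    ring
  have K1 := le_mul_kn hn0
  have K2 := mul_kn_le hn0 hσ hσn
  rw [h_eq_hNum_div]
  refine div_pos ?_ hx3
  unfold hNum
  rw [hsum]
  set s0 := ∑ k ∈ Finset.Icc 1 n, (x - Real.cos (phi n k)) / d k ^ 3
  set s1 := ∑ k ∈ Finset.Icc 1 n, Real.cos (phi n k) / d k ^ 3
  set κ := (n : ℝ) * kn n
  have A0 : 0 < κ * x - s0 := by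
    have := mul_le_mul_of_nonneg_right K1 hx0.le
    linarith
  have A1 : 0 < x ^ 2 * (1 - x ^ 2) * s1 - κ * (1 - x ^ 3) := by
    have t1 := mul_le_mul_of_nonneg_right K2 hx3.le
    have hx2 : 0 < x ^ 2 * (1 - x ^ 2) := by
      have : x ^ 2 < 1 := pow_lt_one₀ hx0.le hx1 two_ne_zero
      exact mul_pos (by positivity) (by linarith)
    have t2 := mul_le_mul_of_nonneg_left
      (by linarith : 2 * (U / r ^ 3) - (n - 2) * (1 / (1 + x) ^ 3) ≤ s1) hx2.le
    linarith
  have : -κ * (ε - x ^ 3) - x ^ 2 * ((1 - ε) * s0 - ε * (1 - x ^ 2) * s1) =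
      (1 - ε) * x ^ 2 * (κ * x - s0) + ε * (x ^ 2 * (1 - x ^ 2) * s1 - κ * (1 - x ^ 3)) := by
    ring
  rw [this]
  have : 0 < 1 - ε := by linarith
  positivity

lemma h_four_pos {ε : ℝ} (hε0 : 0 < ε) (hε1 : ε < 1) : 0 < h 4 (5 / 8) ε := by
  have hs : (1.4142 : ℝ) ≤ √2 := Real.le_sqrt_of_sq_le (by norm_num)
  refine h_pos_of_bounds (U := 0.7071) (r := 0.7119) (q := 1.352) (σ := 0.7071) (by norm_num)
    hε0 hε1 (by norm_num) (by norm_num) ?_ (by norm_num) (by norm_num) (by norm_num)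
    (by norm_num) (by norm_num) (by norm_num) ?_ (by norm_num) (by norm_num)
  · push_cast
    rw [Real.cos_pi_div_four]
    linarith
  · push_cast
    rw [Real.sin_pi_div_four]
    linarith

lemma h_pos_of_five_le {n : ℕ} (hn : 5 ≤ n) {ε : ℝ} (hε0 : 0 < ε) (hε1 : ε < 1) :
    0 < h n (1 - 3 / (2 * n)) ε := by
  have hn5 : (5 : ℝ) ≤ n := by exact_mod_cast hn
  obtain ⟨m, hm0, hm⟩ : ∃ m : ℝ, 0 ≤ m ∧ (n : ℝ) = m + 5 := ⟨n - 5, by linarith, by ring⟩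
  have hpi := Real.pi_gt_d2
  have hpi' := Real.pi_lt_d2
  have ht : Real.pi / n ≤ 0.63 := by
    rw [div_le_iff₀ (by positivity)]
    linarith
  have ht0 : 0 < Real.pi / n := by positivity
  have hx : 1 - 3 / (2 * (n : ℝ)) = (2 * m + 7) / (2 * (m + 5)) := by
    rw [hm]
    field_simp
    ring
  have hrm : (7 / 2 - 2 / (n : ℝ)) / n = (7 * m + 31) / (2 * (m + 5) ^ 2) := by
    rw [hm]
    field_simp
    ring
  refine h_pos_of_bounds (U := 1 - 5 / n ^ 2) (r := (7 / 2 - 2 / n) / n) (q := 6 / n)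
    (σ := 2.8 / n) (by omega) hε0 hε1 ?_ ?_ ?_ ?_ ?_ ?_ (by positivity) ?_ (by positivity)
    ?_ ?_ ?_
  · rw [sub_pos, div_lt_one (by positivity)]
    linarith
  · rw [sub_lt_self_iff]
    positivity
  · refine le_trans ?_ (Real.one_sub_sq_div_two_le_cos)
    rw [div_pow, div_div, sub_le_sub_iff_left, div_le_div_iff₀ (by positivity) (by positivity)]
    have : Real.pi ^ 2 ≤ 10 := by nlinarith
    nlinarith [sq_nonneg (n : ℝ)]
  · rw [sub_le_sub_iff_left, div_le_div_iff₀ (by positivity) (by positivity)]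
    nlinarith
  · refine div_pos ?_ (by positivity)
    rw [sub_pos, div_lt_iff₀ (by positivity)]
    linarith
  · rw [← sub_nonneg, hm]
    field_simp
    ring_nf
    positivity
  · rw [← sub_nonneg, hm]
    field_simp
    ring_nf
    positivity
  · refine le_trans ?_ (Real.sin_gt_sub_cube ht0).le
    have : 0.9 * (Real.pi / n) ≤ Real.pi / n - (Real.pi / n) ^ 3 / 6 := by
      have hsq : (Real.pi / n) ^ 2 ≤ 0.4 := by nlinarith
      nlinarith [mul_le_mul_of_nonneg_left hsq ht0.le]
    refine le_trans ?_ this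
    rw [mul_div_assoc', div_le_div_iff_of_pos_right (by positivity)]
    linarith
  · rw [← sub_pos, hx, hrm, hm]
    field_simp
    ring_nf
    positivity
  · rw [← sub_pos, hx, hrm, hm]
    field_simp
    ring_nf
    positivity

/-- For `n > 3`, `ε ∈ (0,1)`, there is `x₀ ∈ (0,1)` where the derivative of
`x ↦ h(x, ε)` vanishes and `h(x₀, ε) > 0` (degenerate rosette central configuration
at the bifurcation value `μ₀ = h(x₀, ε)`). -/
theorem exists_degenerate_cc (n : ℕ) (hn : 3 < n) (ε : ℝ)
    (hε : ε ∈ Set.Ioo (0 : ℝ) 1) :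
    ∃ x₀ : ℝ, x₀ ∈ Set.Ioo (0 : ℝ) 1 ∧ deriv (fun x => h n x ε) x₀ = 0 ∧
      0 < h n x₀ ε := by
  have hkn : 0 < (n : ℝ) * kn n := by
    refine lt_of_lt_of_le ?_ (le_mul_kn (by omega))
    have : (3 : ℝ) < n := by exact_mod_cast hn
    linarith
  rcases (show 4 ≤ n from hn).eq_or_lt with rfl | h5
  · exact exists_critical_of_pos (by norm_num) hε.1 hε.2 hkn (by norm_num) (by norm_num)
      (h_four_pos hε.1 hε.2)
  · have h5' : (5 : ℝ) ≤ n := by exact_mod_cast h5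
    refine exists_critical_of_pos (by omega) hε.1 hε.2 hkn ?_ ?_ (h_pos_of_five_le h5 hε.1 hε.2)
    · rw [sub_pos, div_lt_one (by positivity)]
      linarith
    · rw [sub_lt_self_iff]
      positivity
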